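/- (Main existence theorem for jointly convex GNEPs.) Let N be a finite set of players, 𝔛 ⊆ ℝⁿ = Π_ν ℝ^{n_ν} convex, compact and nonempty. Suppose each loss function θ_ν : ℝⁿ → ℝ is pseudocontinuous (both lower and upper pseudocontinuous) in its own player's variable x^ν, continuous in the rivals' variables x^{−ν}, and quasiconvex in x^ν. Then there exists a generalized Nash equilibrium: a point x̂ ∈ 𝔛 such that for every player ν and every z^ν with (z^ν, x̂^{−ν}) ∈ 𝔛, θ_ν(x̂^ν, x̂^{−ν}) ≤ θ_ν(z^ν, x̂^{−ν}). -/

import Mathlib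

/-- Scarf dominance of a finite set with respect to a family of orders. -/
def ScarfDom {Y I α : Type*} [LinearOrder α] (r : I → Y → α) (S : Finset Y) : Prop :=
  ∀ y, ∃ i, ∀ s ∈ S, r i y ≤ r i s

/-- Points lying above the minimum of `T` in all orders except the `a`-th one. -/
def ScarfM {Y I α : Type*} [LinearOrder α] (r : I → Y → α) (T : Finset Y) (a : I) (y : Y) : Prop :=
  ∀ i, i ≠ a → ∃ t ∈ T, r i t < r i y

/-- Maximal such points. -/
def ScarfMx {Y I α : Type*} [LinearOrder α] (r : I → Y → α) (T : Finset Y) (a : I) (y : Y) : Prop :=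
  ScarfM r T a y ∧ ∀ z, ScarfM r T a z → r a z ≤ r a y

lemma ScarfDom.mono {Y I α : Type*} [LinearOrder α] {r : I → Y → α} {S T : Finset Y}
    (h : ScarfDom r S) (hT : T ⊆ S) : ScarfDom r T := fun y => by
  obtain ⟨i, hi⟩ := h y
  exact ⟨i, fun s hs => hi s (hT hs)⟩

lemma scarf_eq_a {Y I α : Type*} [LinearOrder α] {r : I → Y → α} {T : Finset Y} {a i : I} {y : Y}
    (hy : ScarfM r T a y) (hi : ∀ s ∈ T, r i y ≤ r i s) : i = a := by
  by_contra h
  obtain ⟨t, ht, hlt⟩ := hy i h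
  exact absurd (hi t ht) (not_le.2 hlt)

lemma scarf_conv {Y I α : Type*} [LinearOrder α] [DecidableEq Y] {r : I → Y → α} {T : Finset Y}
    (hT : ScarfDom r T) {a : I} {y : Y} (hy : ScarfMx r T a y) : ScarfDom r (insert y T) := by
  intro z
  by_cases hz : ScarfM r T a z
  · obtain ⟨i, hi⟩ := hT z
    have := scarf_eq_a hz hi
    subst this
    refine ⟨i, fun s hs => ?_⟩
    rcases Finset.mem_insert.1 hs with rfl | hs
    · exact hy.2 z hz
    · exact hi s hs
  · unfold ScarfM at hz
    push Not at hz
    obtain ⟨k, hk, hz⟩ := hz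
    refine ⟨k, fun s hs => ?_⟩
    rcases Finset.mem_insert.1 hs with rfl | hs
    · obtain ⟨t, ht, hlt⟩ := hy.1 k hk
      exact (hz t ht).trans hlt.le
    · exact hz s hs

lemma scarf_door {Y I α : Type*} [LinearOrder α] [DecidableEq Y] [Fintype I] [DecidableEq I]
    {r : I → Y → α} (hr : ∀ i, Function.Injective (r i)) {T : Finset Y} (hne : T.Nonempty)
    (hT : ScarfDom r T) (hcard : T.card + 1 = Fintype.card I) :
    ∃ a b, a ≠ b ∧ (∃ t ∈ T, (∀ s ∈ T, r a t ≤ r a s) ∧ (∀ s ∈ T, r b t ≤ r b s)) ∧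
      ∀ y, (y ∉ T ∧ ScarfDom r (insert y T)) ↔ (ScarfMx r T a y ∨ ScarfMx r T b y) := by
  have hm : ∀ i, ∃ t ∈ T, ∀ s ∈ T, r i t ≤ r i s := fun i => T.exists_min_image (r i) hne
  choose m hmT hmin using hm
  have huniq : ∀ i t, t ∈ T → (∀ s ∈ T, r i t ≤ r i s) → m i = t := fun i t ht h =>
    hr i (le_antisymm (hmin i t ht) (h _ (hmT i)))
  have hsurj : ∀ t ∈ T, ∃ i, m i = t := fun t ht => by
    obtain ⟨i, hi⟩ := hT t
    exact ⟨i, huniq i t ht hi⟩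
  obtain ⟨a, -, b, -, hab, hmab⟩ := Finset.exists_ne_map_eq_of_card_lt_of_maps_to
    (s := (Finset.univ : Finset I)) (t := T) (f := m) (by rw [Finset.card_univ]; omega)
    (fun i _ => hmT i)
  have hinj : ∀ a b : I, a ≠ b → m a = m b → ∀ i j, i ≠ a → j ≠ a → m i = m j → i = j := by
    intro a b hab hmab i j hi hj hij
    have h1 : ((Finset.univ.erase a).image m) = T := by
      ext t
      simp only [Finset.mem_image, Finset.mem_erase, Finset.mem_univ, and_true]
      constructor
      · rintro ⟨i, _, rfl⟩; exact hmT i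
      · intro ht
        obtain ⟨i, hi⟩ := hsurj t ht
        by_cases hia : i = a
        · exact ⟨b, hab.symm, by rw [← hmab, ← hia, hi]⟩
        · exact ⟨i, hia, hi⟩
    have h2 : ((Finset.univ.erase a).image m).card = (Finset.univ.erase a).card := by
      rw [h1, Finset.card_erase_of_mem (Finset.mem_univ _), Finset.card_univ]; omega
    exact Finset.card_image_iff.1 h2 (by simp [hi]) (by simp [hj]) hij
  have hA := hinj a b hab hmab
  have hB := hinj b a hab.symm hmab.symm
  have hnot : ∀ a b : I, a ≠ b → m a = m b → ∀ y, ScarfM r T a y → y ∉ T := by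
    intro a b hab hmab y hy hyT
    obtain ⟨i, hi⟩ := hT y
    have := scarf_eq_a hy hi
    subst this
    have h1 := huniq i y hyT hi
    obtain ⟨t, ht, hlt⟩ := hy b hab.symm
    rw [← h1, hmab] at hlt
    exact absurd (hmin b t ht) (not_le.2 hlt)
  -- forward direction helper
  have hfwd : ∀ a b : I, (∀ i j, i ≠ a → j ≠ a → m i = m j → i = j) → ∀ y, y ∉ T →
      ScarfDom r (insert y T) → (∀ s ∈ insert y T, r a y ≤ r a s) → ScarfMx r T a y := by
    intro a b hA y hyT hd hya
    constructor
    · intro k hk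
      obtain ⟨j, hj⟩ := hd (m k)
      have hjm : m j = m k := huniq j (m k) (hmT k) (fun s hs => hj s (Finset.mem_insert_of_mem hs))
      have hjy := hj y (Finset.mem_insert_self _ _)
      have hjk : j = k := by
        by_contra hne
        have hja : j = a := by
          by_contra hja
          exact hne (hA j k hja hk hjm)
        subst hja
        have h1 := hya (m k) (Finset.mem_insert_of_mem (hmT k))
        have := hr j (le_antisymm h1 hjy)
        exact hyT (this ▸ hmT k)
      subst hjk
      refine ⟨m j, hmT j, lt_of_le_of_ne hjy fun h => ?_⟩
      exact hyT (hr j h ▸ hmT j)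
    · intro z hz
      obtain ⟨i, hi⟩ := hd z
      have := scarf_eq_a hz (fun s hs => hi s (Finset.mem_insert_of_mem hs))
      subst this
      exact hi y (Finset.mem_insert_self _ _)
  refine ⟨a, b, hab, ⟨m a, hmT a, hmin a, by rw [hmab]; exact hmin b⟩, fun y => ⟨?_, ?_⟩⟩
  · rintro ⟨hyT, hd⟩
    obtain ⟨i, hi⟩ := hd y
    have key : i = a ∨ i = b := by
      obtain ⟨j, hj⟩ := hd (m i)
      have hjm : m j = m i := huniq j (m i) (hmT i) (fun s hs => hj s (Finset.mem_insert_of_mem hs))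
      have hji : j ≠ i := by
        rintro rfl
        have := hr j (le_antisymm (hj y (Finset.mem_insert_self _ _))
          (hi _ (Finset.mem_insert_of_mem (hmT j))))
        exact hyT (this ▸ hmT j)
      by_contra hcon
      push Not at hcon
      have h1 : j = a := by
        by_contra h; exact hji (hA j i h hcon.1 hjm)
      have h2 : j = b := by
        by_contra h; exact hji (hB j i h hcon.2 hjm)
      exact hab (h1 ▸ h2)
    rcases key with rfl | rfl
    · exact Or.inl (hfwd i b hA y hyT hd hi)
    · exact Or.inr (hfwd i a hB y hyT hd hi)
  · rintro (h | h)
    · exact ⟨hnot a b hab hmab y h.1, scarf_conv hT h⟩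
    · exact ⟨hnot b a hab.symm hmab.symm y h.1, scarf_conv hT h⟩

lemma scarf_exists_mx {Y I α : Type*} [LinearOrder α] [Fintype Y]
    (r : I → Y → α) (T : Finset Y) (a : I) (h : ∃ y, ScarfM r T a y) : ∃ y, ScarfMx r T a y := by
  classical
  obtain ⟨y, hy⟩ := h
  obtain ⟨z, hz, hmax⟩ := (Finset.univ.filter (ScarfM r T a)).exists_max_image (r a) ⟨y, by simpa⟩
  exact ⟨z, by simpa using hz, fun w hw => hmax w (by simpa using hw)⟩

open Classical in
lemma scarf_count {Y I α : Type*} [LinearOrder α] [Fintype Y] [Fintype I] [Nontrivial I]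
    {r : I → Y → α} (hr : ∀ i, Function.Injective (r i)) (e : I → Y)
    (hinj : Function.Injective e)
    (he1 : ∀ i y, r i (e i) ≤ r i y)
    (he2 : ∀ i j, j ≠ i → ∀ y, y ∉ Set.range e → r i y < r i (e j))
    {T : Finset Y} (hT : ScarfDom r T) (hcard : T.card + 1 = Fintype.card I) :
    ((¬ (T : Set Y) ⊆ Set.range e) →
      (Finset.univ.filter fun y => y ∉ T ∧ ScarfDom r (insert y T)).card = 2) ∧
    (∀ k, T = (Finset.univ.erase k).image e →
      (Finset.univ.filter fun y => y ∉ T ∧ ScarfDom r (insert y T)).card = 1) := by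
  have hne : T.Nonempty := by
    rw [← Finset.card_pos]
    have := Fintype.one_lt_card (α := I)
    omega
  obtain ⟨a, b, hab, ⟨t, htT, hta, htb⟩, hiff⟩ := scarf_door hr hne hT hcard
  simp_rw [hiff]
  have hmxu : ∀ a y z, ScarfMx r T a y → ScarfMx r T a z → y = z := fun a y z hy hz =>
    hr a (le_antisymm (hz.2 y hy.1) (hy.2 z hz.1))
  constructor
  · intro hsub
    obtain ⟨x, hx, hxe⟩ := Set.not_subset.1 hsub
    have hM : ∀ a, ScarfM r T a (e a) := fun a i hi => ⟨x, hx, he2 i a hi.symm x hxe⟩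
    obtain ⟨ya, hya⟩ := scarf_exists_mx r T a ⟨_, hM a⟩
    obtain ⟨yb, hyb⟩ := scarf_exists_mx r T b ⟨_, hM b⟩
    have hne : ya ≠ yb := by
      rintro rfl
      obtain ⟨i, hi⟩ := hT ya
      exact hab ((scarf_eq_a hya.1 hi).symm.trans (scarf_eq_a hyb.1 hi))
    rw [Finset.card_eq_two]
    refine ⟨ya, yb, hne, ?_⟩
    ext y
    simp only [Finset.mem_filter, Finset.mem_univ, true_and, Finset.mem_insert,
      Finset.mem_singleton]
    constructor
    · rintro (h | h)
      · exact Or.inl (hmxu a _ _ h hya)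
      · exact Or.inr (hmxu b _ _ h hyb)
    · rintro (rfl | rfl)
      · exact Or.inl hya
      · exact Or.inr hyb
  · intro k hk
    have hmem : ∀ i, i ≠ k → e i ∈ T := fun i hi => by
      rw [hk]; exact Finset.mem_image_of_mem _ (by simp [hi])
    have hmem' : ∀ t ∈ T, ∃ i, i ≠ k ∧ e i = t := fun t ht => by
      rw [hk] at ht
      simpa using ht
    have hMk : ScarfM r T k (e k) := fun i hi =>
      ⟨e i, hmem i hi, lt_of_le_of_ne (he1 i _) fun h => hi (hinj (hr i h))⟩
    obtain ⟨y0, hy0⟩ := scarf_exists_mx r T k ⟨_, hMk⟩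
    have hemin : ∀ i, i ≠ k → (∀ s ∈ T, r i t ≤ r i s) → t = e i := fun i hi h =>
      hr i (le_antisymm (h _ (hmem i hi)) (he1 i t))
    have hempty : ∀ j, j ≠ k → t = e j → (∀ s ∈ T, r k t ≤ r k s) → ∀ y, ¬ ScarfM r T j y := by
      intro j hj htj hmin y hy
      obtain ⟨s, hs, hlt⟩ := hy k hj.symm
      by_cases hye : y ∈ Set.range e
      · obtain ⟨l, rfl⟩ := hye
        by_cases hl : l = j
        · subst hl
          rw [← htj] at hlt
          exact absurd (hmin s hs) (not_le.2 hlt)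
        · obtain ⟨s', hs', hlt'⟩ := hy l hl
          exact absurd (he1 l s') (not_le.2 hlt')
      · obtain ⟨l, hl, rfl⟩ := hmem' s hs
        exact absurd hlt (not_lt.2 (he2 k l hl y hye).le)
    have fin : ∀ (P : Y → Prop) [DecidablePred P], (∀ y, P y ↔ ScarfMx r T k y) →
        (Finset.univ.filter P).card = 1 := by
      intro P _ hP
      rw [Finset.card_eq_one]
      refine ⟨y0, ?_⟩
      ext y
      simp only [Finset.mem_filter, Finset.mem_univ, true_and, Finset.mem_singleton, hP]
      exact ⟨fun h => hmxu k _ _ h hy0, fun h => h ▸ hy0⟩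
    apply fin
    intro y
    by_cases hak : a = k
    · subst hak
      have := hempty b hab.symm (hemin b hab.symm htb) hta
      exact ⟨fun h => h.resolve_right fun h => this y h.1, Or.inl⟩
    · have hbk : b = k := by
        by_contra hbk
        exact hab (hinj ((hemin a hak hta).symm.trans (hemin b hbk htb)))
      subst hbk
      have := hempty a hak (hemin a hak hta) htb
      exact ⟨fun h => h.resolve_left fun h => this y h.1, Or.inr⟩

open Classical in
lemma scarf_room_even {Y I : Type*} [Fintype I] (c : Y → I) (i0 : I) (S : Finset Y)
    (hcard : S.card = Fintype.card I) (hnc : S.image c ≠ Finset.univ) :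
    Even (S.filter fun y => (S.erase y).image c = Finset.univ.erase i0).card := by
  by_cases hQ : ∃ y0 ∈ S, (S.erase y0).image c = Finset.univ.erase i0
  · obtain ⟨y0, hy0, him⟩ := hQ
    have hinj : Set.InjOn c (S.erase y0) := by
      apply Finset.card_image_iff.1
      rw [him, Finset.card_erase_of_mem hy0, Finset.card_erase_of_mem (Finset.mem_univ _),
        Finset.card_univ, hcard]
    have hSim : S.image c = insert (c y0) (Finset.univ.erase i0) := by
      rw [← him, ← Finset.image_insert, Finset.insert_erase hy0]
    have hc0 : c y0 ≠ i0 := by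
      intro h
      apply hnc
      rw [hSim, h, Finset.insert_erase (Finset.mem_univ _)]
    have h1 : c y0 ∈ (S.erase y0).image c := by rw [him]; simp [hc0]
    obtain ⟨y1, hy1, hc1⟩ := Finset.mem_image.1 h1
    have hne : y1 ≠ y0 := (Finset.mem_erase.1 hy1).1
    have hy1S := (Finset.mem_erase.1 hy1).2
    have : (S.filter fun y => (S.erase y).image c = Finset.univ.erase i0) = {y0, y1} := by
      ext y
      simp only [Finset.mem_filter, Finset.mem_insert, Finset.mem_singleton]
      constructor
      · rintro ⟨hyS, hy⟩
        by_contra hcon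
        push Not at hcon
        have h2 : c y ∈ (S.erase y).image c := by
          rw [hy, ← him]
          exact Finset.mem_image_of_mem _ (Finset.mem_erase.2 ⟨hcon.1, hyS⟩)
        obtain ⟨y', hy', hcy'⟩ := Finset.mem_image.1 h2
        have hyE2 := Finset.mem_erase.1 hy'
        have hyE : y ∈ S.erase y0 := Finset.mem_erase.2 ⟨hcon.1, hyS⟩
        by_cases h3 : y' = y0
        · apply hcon.2
          exact hinj (by exact_mod_cast hyE) (by exact_mod_cast hy1) (by rw [hc1, ← hcy', h3])
        · exact hyE2.1 (hinj (by exact_mod_cast Finset.mem_erase.2 ⟨h3, hyE2.2⟩)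
            (by exact_mod_cast hyE) hcy')
      · rintro (rfl | rfl)
        · exact ⟨hy0, him⟩
        · refine ⟨hy1S, ?_⟩
          rw [← him]
          ext i
          simp only [Finset.mem_image, Finset.mem_erase]
          constructor
          · rintro ⟨z, ⟨hz, hzS⟩, rfl⟩
            by_cases h : z = y0
            · exact ⟨y, ⟨hne, hy1S⟩, by rw [h, hc1]⟩
            · exact ⟨z, ⟨h, hzS⟩, rfl⟩
          · rintro ⟨z, ⟨hz, hzS⟩, rfl⟩
            by_cases h : z = y
            · exact ⟨y0, ⟨hne.symm, hy0⟩, by rw [h, hc1]⟩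
            · exact ⟨z, ⟨h, hzS⟩, rfl⟩
    rw [this, Finset.card_pair hne.symm]
    exact even_two
  · push Not at hQ
    rw [Finset.filter_eq_empty_iff.2 (fun y hy => hQ y hy)]
    simp

open Classical in
/-- Scarf's combinatorial lemma. -/
theorem scarf_lemma {Y I α : Type*} [LinearOrder α] [Fintype Y] [Fintype I] [Nontrivial I]
    {r : I → Y → α} (hr : ∀ i, Function.Injective (r i)) (e : I → Y)
    (hinj : Function.Injective e)
    (he1 : ∀ i y, r i (e i) ≤ r i y)
    (he2 : ∀ i j, j ≠ i → ∀ y, y ∉ Set.range e → r i y < r i (e j))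
    (c : Y → I) (hc : ∀ i, c (e i) = i) :
    ∃ S : Finset Y, ScarfDom r S ∧ S.card = Fintype.card I ∧ S.image c = Finset.univ := by
  by_contra hcon
  push Not at hcon
  obtain ⟨i0⟩ : Nonempty I := inferInstance
  have hI : 0 < Fintype.card I := Fintype.card_pos
  set D : Finset (Finset Y) := Finset.univ.filter fun T =>
    ScarfDom r T ∧ T.card + 1 = Fintype.card I ∧ T.image c = Finset.univ.erase i0 with hD
  set R : Finset (Finset Y) := Finset.univ.filter fun S =>
    ScarfDom r S ∧ S.card = Fintype.card I with hR
  have hdc := Finset.sum_card_bipartiteAbove_eq_sum_card_bipartiteBelow (s := D) (t := R)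
    (fun T S => T ⊆ S)
  -- rooms
  have hrooms : ∀ S ∈ R, Even (D.bipartiteBelow (fun T S => T ⊆ S) S).card := by
    intro S hS
    simp only [hR, Finset.mem_filter, Finset.mem_univ, true_and] at hS
    have h := scarf_room_even c i0 S hS.2 (hcon S hS.1 hS.2)
    have : D.bipartiteBelow (fun T S => T ⊆ S) S =
        (S.filter fun y => (S.erase y).image c = Finset.univ.erase i0).image (fun y => S.erase y) := by
      ext T
      simp only [hD, Finset.mem_bipartiteBelow, Finset.mem_filter, Finset.mem_univ, true_and,
        Finset.mem_image]
      constructor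
      · rintro ⟨⟨hT, hTc, hTi⟩, hTS⟩
        have : (S \ T).card = 1 := by
          rw [Finset.card_sdiff_of_subset hTS]; omega
        obtain ⟨y, hy⟩ := Finset.card_eq_one.1 this
        have hyS : y ∈ S \ T := by rw [hy]; simp
        have hST : S.erase y = T := by
          rw [Finset.erase_eq, ← hy, Finset.sdiff_sdiff_eq_self hTS]
        exact ⟨y, ⟨(Finset.mem_sdiff.1 hyS).1, by rw [hST, hTi]⟩, hST⟩
      · rintro ⟨y, ⟨hyS, hyi⟩, rfl⟩
        refine ⟨⟨hS.1.mono (Finset.erase_subset _ _), ?_, hyi⟩, Finset.erase_subset _ _⟩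
        rw [Finset.card_erase_of_mem hyS]; omega
    rw [this, Finset.card_image_of_injOn]
    · exact h
    · intro x hx y hy hxy
      have hx := (Finset.mem_filter.1 (Finset.mem_coe.1 hx)).1
      exact (Finset.erase_inj S hx).1 hxy
  -- doors
  have hdoor : ∀ T ∈ D, (R.bipartiteAbove (fun T S => T ⊆ S) T).card =
      (Finset.univ.filter fun y => y ∉ T ∧ ScarfDom r (insert y T)).card := by
    intro T hT
    simp only [hD, Finset.mem_filter, Finset.mem_univ, true_and] at hT
    have : R.bipartiteAbove (fun T S => T ⊆ S) T =
        (Finset.univ.filter fun y => y ∉ T ∧ ScarfDom r (insert y T)).image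
          (fun y => insert y T) := by
      ext S
      simp only [hR, Finset.mem_bipartiteAbove, Finset.mem_filter, Finset.mem_univ, true_and,
        Finset.mem_image]
      constructor
      · rintro ⟨⟨hS, hSc⟩, hTS⟩
        have : (S \ T).card = 1 := by
          rw [Finset.card_sdiff_of_subset hTS]; omega
        obtain ⟨y, hy⟩ := Finset.card_eq_one.1 this
        have hyS : y ∈ S \ T := by rw [hy]; simp
        have hST : insert y T = S := by
          rw [Finset.insert_eq, ← hy, Finset.sdiff_union_of_subset hTS]
        exact ⟨y, ⟨(Finset.mem_sdiff.1 hyS).2, by rwa [hST]⟩, hST⟩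
      · rintro ⟨y, ⟨hyT, hyd⟩, rfl⟩
        refine ⟨⟨hyd, ?_⟩, Finset.subset_insert _ _⟩
        rw [Finset.card_insert_of_notMem hyT]; omega
    rw [this, Finset.card_image_of_injOn]
    intro x hx y hy hxy
    have hx := (Finset.mem_filter.1 (Finset.mem_coe.1 hx)).2.1
    exact (Finset.insert_inj hx).1 hxy
  set T0 : Finset Y := (Finset.univ.erase i0).image e with hT0
  have hT0D : T0 ∈ D := by
    simp only [hD, Finset.mem_filter, Finset.mem_univ, true_and]
    refine ⟨?_, ?_, ?_⟩
    · intro y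
      by_cases hy : y ∈ Set.range e
      · obtain ⟨j, rfl⟩ := hy
        exact ⟨j, fun s _ => he1 j s⟩
      · refine ⟨i0, fun s hs => ?_⟩
        obtain ⟨j, hj, rfl⟩ := Finset.mem_image.1 hs
        exact (he2 i0 j (Finset.mem_erase.1 hj).1 y hy).le
    · rw [hT0, Finset.card_image_of_injective _ hinj,
        Finset.card_erase_of_mem (Finset.mem_univ _), Finset.card_univ]
      omega
    · rw [hT0, Finset.image_image]
      have : c ∘ e = id := funext hc
      rw [this, Finset.image_id]
  have hE : Even (∑ T ∈ D, (R.bipartiteAbove (fun T S => T ⊆ S) T).card) := by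
    rw [hdc]
    exact Finset.even_sum _ hrooms
  rw [← Finset.add_sum_erase _ _ hT0D] at hE
  have h1 : (R.bipartiteAbove (fun T S => T ⊆ S) T0).card = 1 := by
    rw [hdoor T0 hT0D]
    have h := hT0D
    simp only [hD, Finset.mem_filter, Finset.mem_univ, true_and] at h
    exact (scarf_count hr e hinj he1 he2 h.1 h.2.1).2 i0 rfl
  have h2 : Even (∑ T ∈ D.erase T0, (R.bipartiteAbove (fun T S => T ⊆ S) T).card) := by
    apply Finset.even_sum
    intro T hT
    obtain ⟨hTne, hTD⟩ := Finset.mem_erase.1 hT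
    rw [hdoor T hTD]
    have h := hTD
    simp only [hD, Finset.mem_filter, Finset.mem_univ, true_and] at h
    rw [(scarf_count hr e hinj he1 he2 h.1 h.2.1).1]
    · exact even_two
    · intro hsub
      apply hTne
      rw [hT0]
      ext y
      simp only [Finset.mem_image, Finset.mem_erase, Finset.mem_univ, and_true]
      constructor
      · intro hy
        obtain ⟨j, rfl⟩ := hsub hy
        refine ⟨j, ?_, rfl⟩
        have := Finset.mem_image_of_mem c hy
        rw [h.2.2, hc] at this
        exact (Finset.mem_erase.1 this).1
      · rintro ⟨j, hj, rfl⟩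
        have : j ∈ T.image c := by rw [h.2.2]; simp [hj]
        obtain ⟨y, hy, hyj⟩ := Finset.mem_image.1 this
        obtain ⟨l, rfl⟩ := hsub hy
        rw [hc] at hyj
        rwa [← hyj]
  rw [h1, Nat.even_add] at hE
  exact absurd (hE.2 h2) (by decide)

lemma scarf_geom {I : Type*} [Fintype I] (X σ : Finset (I → ℝ)) (C : Finset I)
    (hX : ∀ x ∈ X, x ∈ stdSimplex ℝ I) (hσX : σ ⊆ X) (hσ : σ.Nonempty) (hX0 : X.Nonempty)
    (η : ℝ) (hη : 0 < η) (hnet : ∀ p ∈ stdSimplex ℝ I, ∃ x ∈ X, dist p x < η)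
    (hdom : ∀ x ∈ X, ∃ i ∈ C, ∀ s ∈ σ, x i ≤ s i) :
    ∃ m : I → ℝ, (∀ i, i ∉ C → m i = 0) ∧
      ∀ s ∈ σ, ∀ i, m i ≤ s i ∧ s i ≤ m i + Fintype.card I * η := by
  classical
  have hmin : ∀ i, ∃ t ∈ σ, ∀ s ∈ σ, t i ≤ s i := fun i => σ.exists_min_image (fun x => x i) hσ
  choose t htσ htmin using hmin
  set m : I → ℝ := fun i => if i ∈ C then t i i else 0 with hm
  have hCne : 0 < C.card := by
    obtain ⟨x, hx⟩ := hX0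
    obtain ⟨i, hi, _⟩ := hdom x hx
    exact Finset.card_pos.2 ⟨i, hi⟩
  have hCn : (0:ℝ) < C.card := by exact_mod_cast hCne
  have hms : ∀ s ∈ σ, ∀ i, m i ≤ s i := by
    intro s hs i
    simp only [hm]
    split_ifs with h
    · exact htmin i s hs
    · exact (hX s (hσX hs)).1 i
  have hm0 : ∀ i, 0 ≤ m i := by
    intro i
    simp only [hm]
    split_ifs with h
    · exact (hX _ (hσX (htσ i))).1 i
    · exact le_rfl
  have hmsum : ∑ i, m i ≤ 1 := by
    obtain ⟨s, hs⟩ := hσ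
    rw [← (hX s (hσX hs)).2]
    exact Finset.sum_le_sum fun i _ => hms s hs i
  set d : ℝ := (1 - ∑ i, m i) / C.card with hd
  have hd0 : 0 ≤ d := div_nonneg (by linarith) hCn.le
  have hdC : (C.card : ℝ) * d = 1 - ∑ i, m i := by rw [hd]; field_simp
  obtain ⟨x, hxX, hx⟩ := hnet (fun i => m i + if i ∈ C then d else 0) (by
    refine ⟨fun i => ?_, ?_⟩
    · have := hm0 i
      show 0 ≤ m i + if i ∈ C then d else 0
      split_ifs <;> linarith
    · have h : (∑ i : I, if i ∈ C then d else 0) = C.card * d := by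
        rw [Finset.sum_ite_mem, Finset.univ_inter, Finset.sum_const, nsmul_eq_mul]
      rw [Finset.sum_add_distrib, h, hdC]
      ring)
  obtain ⟨i, hiC, hi⟩ := hdom x hxX
  have h1 := (dist_le_pi_dist _ _ i).trans_lt hx
  have h2 := hi _ (htσ i)
  rw [Real.dist_eq] at h1
  have h3 := (abs_lt.1 h1).2
  simp only [hm, hiC, if_true] at h3
  have hdη : d ≤ η := by linarith
  have hCI : (C.card : ℝ) ≤ Fintype.card I := by exact_mod_cast Finset.card_le_univ C
  have h4 : 1 - ∑ i, m i ≤ Fintype.card I * η := by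
    rw [← hdC]
    exact mul_le_mul hCI hdη hd0 (by positivity)
  refine ⟨m, fun i hi => by simp [hm, hi], fun s hs i => ⟨hms s hs i, ?_⟩⟩
  have h5 : s i - m i ≤ ∑ j, (s j - m j) :=
    Finset.single_le_sum (f := fun j => s j - m j) (fun j _ => sub_nonneg.2 (hms s hs j))
      (Finset.mem_univ i)
  rw [Finset.sum_sub_distrib, (hX s (hσX hs)).2] at h5
  linarith

lemma brouwer_approx {I : Type*} [Fintype I] [Nontrivial I] (f : (I → ℝ) → (I → ℝ))
    (hf : ContinuousOn f (stdSimplex ℝ I)) (hmaps : Set.MapsTo f (stdSimplex ℝ I) (stdSimplex ℝ I))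
    (ε : ℝ) (hε : 0 < ε) : ∃ x ∈ stdSimplex ℝ I, ∀ i, x i ≤ f x i + ε := by
  classical
  have huc := (isCompact_stdSimplex (𝕜 := ℝ) I).uniformContinuousOn_of_continuous hf
  rw [Metric.uniformContinuousOn_iff] at huc
  obtain ⟨δ, hδ, huc⟩ := huc (ε / 2) (by positivity)
  have hn : (0:ℝ) < Fintype.card I := by exact_mod_cast Fintype.card_pos
  set κ := min (δ / 2) (ε / 2) with hκ
  have hκ0 : 0 < κ := by positivity
  obtain ⟨X', hX'sub, hX'fin, hX'cov⟩ := (isCompact_stdSimplex (𝕜 := ℝ) I).finite_cover_balls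
    (e := κ / Fintype.card I) (by positivity)
  obtain ⟨X, rfl⟩ := hX'fin.exists_finset_coe
  have hnet : ∀ p ∈ stdSimplex ℝ I, ∃ x ∈ X, dist p x < κ / Fintype.card I := by
    intro p hp
    simpa using hX'cov hp
  have hXs : ∀ x ∈ X, x ∈ stdSimplex ℝ I := fun x hx => hX'sub hx
  obtain ⟨j0⟩ : Nonempty I := inferInstance
  obtain ⟨x0, hx0, _⟩ := hnet _ (single_mem_stdSimplex ℝ j0)
  let ix := Fintype.equivFin X
  let ii := Fintype.equivFin I
  let r : I → (X ⊕ I) → ℝ ×ₗ ℕ := fun i y => match y with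
    | Sum.inl x => toLex (x.1 i, (ix x : ℕ))
    | Sum.inr j => if j = i then toLex (-1, 0) else toLex (2, (ii j : ℕ))
  have hcol : ∀ x : X, ∃ i, x.1 i ≤ f x.1 i := by
    intro x
    by_contra h
    push Not at h
    have := Finset.sum_lt_sum_of_nonempty (s := Finset.univ) (f := f x.1) (g := x.1)
      ⟨j0, Finset.mem_univ _⟩ (fun i _ => h i)
    rw [(hXs _ x.2).2, (hmaps (hXs _ x.2)).2] at this
    exact lt_irrefl _ this
  choose col hcol using hcol
  let c : X ⊕ I → I := Sum.elim col id
  have hx01 : ∀ x : X, ∀ i, 0 ≤ x.1 i ∧ x.1 i ≤ 1 := fun x i => by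
    have := mem_Icc_of_mem_stdSimplex (hXs _ x.2) i
    exact this
  obtain ⟨S, hSd, -, hSc⟩ := scarf_lemma (r := r) (by
      intro i y z h
      rcases y with x | j <;> rcases z with x' | j' <;> simp only [r] at h
      · have h := congrArg (fun p => (ofLex p).2) h
        simp only [ofLex_toLex] at h
        exact congrArg _ (ix.injective (Fin.ext h))
      · have h := congrArg (fun p => (ofLex p).1) h
        have := hx01 x i
        split_ifs at h <;> simp only [ofLex_toLex] at h <;> linarith
      · have h := congrArg (fun p => (ofLex p).1) h
        have := hx01 x' i
        split_ifs at h <;> simp only [ofLex_toLex] at h <;> linarith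
      · split_ifs at h with h1 h2 h2
        · rw [h1, h2]
        · have h := congrArg (fun p => (ofLex p).1) h
          simp only [ofLex_toLex] at h; norm_num at h
        · have h := congrArg (fun p => (ofLex p).1) h
          simp only [ofLex_toLex] at h; norm_num at h
        · have h := congrArg (fun p => (ofLex p).2) h
          simp only [ofLex_toLex] at h
          exact congrArg _ (ii.injective (Fin.ext h)))
    Sum.inr Sum.inr_injective
    (by
      intro i y
      rcases y with x | j
      · have := hx01 x i
        simp only [r, if_true]
        rw [Prod.Lex.toLex_le_toLex]
        left; simp only; linarith
      · simp only [r, if_true]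
        split_ifs
        · exact le_rfl
        · rw [Prod.Lex.toLex_le_toLex]
          left; norm_num)
    (by
      intro i j hj y hy
      rcases y with x | k
      · have := hx01 x i
        simp only [r, hj, if_false]
        rw [Prod.Lex.toLex_lt_toLex]
        left; simp only; linarith
      · exact absurd ⟨k, rfl⟩ hy)
    c (fun i => rfl)
  set C : Finset I := Finset.univ.filter fun i => Sum.inr i ∉ S with hC
  set σ : Finset (I → ℝ) := (Finset.univ.filter fun x : X => Sum.inl x ∈ S).image Subtype.val with hσ
  have hσm : ∀ x : X, Sum.inl x ∈ S → x.1 ∈ σ := fun x hx =>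
    Finset.mem_image_of_mem _ (by simpa using hx)
  have hσm' : ∀ s ∈ σ, ∃ x : X, Sum.inl x ∈ S ∧ x.1 = s := fun s hs => by
    obtain ⟨x, hx, hxs⟩ := Finset.mem_image.1 hs
    exact ⟨x, (Finset.mem_filter.1 hx).2, hxs⟩
  have hcolor : ∀ i ∈ C, ∃ s ∈ σ, s i ≤ f s i := by
    intro i hi
    have : i ∈ S.image c := by rw [hSc]; simp
    obtain ⟨y, hy, hyi⟩ := Finset.mem_image.1 this
    rcases y with x | j
    · have hyi : col x = i := hyi
      exact ⟨x.1, hσm x hy, by rw [← hyi]; exact hcol x⟩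
    · have hyi : j = i := hyi
      subst hyi
      exact absurd hy (Finset.mem_filter.1 hi).2
  have hdom : ∀ x ∈ X, ∃ i ∈ C, ∀ s ∈ σ, x i ≤ s i := by
    intro x hx
    obtain ⟨i, hi⟩ := hSd (Sum.inl ⟨x, hx⟩)
    refine ⟨i, ?_, ?_⟩
    · simp only [hC, Finset.mem_filter, Finset.mem_univ, true_and]
      intro hmem
      have := hi _ hmem
      simp only [r, if_true] at this
      rw [Prod.Lex.toLex_le_toLex] at this
      have h2 := hx01 ⟨x, hx⟩ i
      simp only at this h2
      rcases this with h | ⟨h, _⟩ <;> linarith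
    · intro s hs
      obtain ⟨x', hx', rfl⟩ := hσm' s hs
      have := hi _ hx'
      simp only [r] at this
      rw [Prod.Lex.toLex_le_toLex] at this
      rcases this with h | ⟨h, _⟩
      · exact h.le
      · exact h.le
  have hσne : σ.Nonempty := by
    obtain ⟨i, hi, _⟩ := hdom x0 hx0
    obtain ⟨s, hs, _⟩ := hcolor i hi
    exact ⟨s, hs⟩
  have hσX : σ ⊆ X := by
    intro s hs
    obtain ⟨x, _, rfl⟩ := hσm' s hs
    exact x.2
  obtain ⟨m, hm0, hm⟩ := scarf_geom X σ C hXs hσX hσne ⟨x0, hx0⟩ _ (by positivity) hnet hdom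
  rw [mul_div_cancel₀ _ hn.ne'] at hm
  obtain ⟨s, hs⟩ := hσne
  have hsΔ := hXs s (hσX hs)
  have hκδ : κ ≤ δ / 2 := min_le_left _ _
  have hκε : κ ≤ ε / 2 := min_le_right _ _
  refine ⟨s, hsΔ, fun i => ?_⟩
  by_cases hi : i ∈ C
  · obtain ⟨x, hx, hxi⟩ := hcolor i hi
    have hd : dist x s < δ := by
      rw [dist_pi_lt_iff hδ]
      intro j
      have h1 := hm s hs j
      have h2 := hm x hx j
      rw [Real.dist_eq, abs_lt]
      constructor <;> linarith [h1.1, h1.2, h2.1, h2.2]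
    have h3 := (dist_le_pi_dist _ _ i).trans_lt (huc x (hXs x (hσX hx)) s hsΔ hd)
    rw [Real.dist_eq] at h3
    have h4 := (abs_lt.1 h3).2
    have h1 := hm s hs i
    have h2 := hm x hx i
    linarith [h1.1, h1.2, h2.1, h2.2]
  · have h1 := hm s hs i
    rw [hm0 i hi] at h1
    have h2 := (hmaps hsΔ).1 i
    linarith [h1.2]

/-- Brouwer's fixed point theorem on the standard simplex. -/
theorem brouwer_simplex {I : Type*} [Fintype I] [Nonempty I] (f : (I → ℝ) → (I → ℝ))
    (hf : ContinuousOn f (stdSimplex ℝ I))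
    (hmaps : Set.MapsTo f (stdSimplex ℝ I) (stdSimplex ℝ I)) :
    ∃ x ∈ stdSimplex ℝ I, f x = x := by
  classical
  obtain ⟨j0⟩ : Nonempty I := inferInstance
  rcases subsingleton_or_nontrivial I with hs | hnt
  · refine ⟨_, single_mem_stdSimplex ℝ j0, ?_⟩
    have h := hmaps (single_mem_stdSimplex ℝ j0)
    rw [stdSimplex_unique] at h
    have h2 := single_mem_stdSimplex ℝ j0
    rw [stdSimplex_unique] at h2
    rw [Set.mem_singleton_iff.1 h, ← Set.mem_singleton_iff.1 h2]
  · have hcont : ContinuousOn (fun x : I → ℝ => ∑ i, max (x i - f x i) 0) (stdSimplex ℝ I) := by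
      refine continuousOn_finsetSum _ fun i _ => ?_
      have h1 : ContinuousOn (fun x => f x i) (stdSimplex ℝ I) :=
        (continuous_apply i).comp_continuousOn hf
      have h2 : ContinuousOn (fun x : I → ℝ => x i) (stdSimplex ℝ I) :=
        (continuous_apply i).continuousOn
      exact (h2.sub h1).sup continuousOn_const
    obtain ⟨x, hx, hmin⟩ := (isCompact_stdSimplex (𝕜 := ℝ) I).exists_isMinOn
      ⟨_, single_mem_stdSimplex ℝ j0⟩ hcont
    have hn : (0:ℝ) < Fintype.card I := by exact_mod_cast Fintype.card_pos
    have hle : ∑ i, max (x i - f x i) 0 ≤ 0 := by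
      apply le_of_forall_pos_le_add
      intro ε hε
      obtain ⟨y, hy, hyε⟩ := brouwer_approx f hf hmaps (ε / Fintype.card I) (by positivity)
      have h1 : ∑ i, max (x i - f x i) 0 ≤ ∑ i, max (y i - f y i) 0 := hmin hy
      have h2 : ∑ i, max (y i - f y i) 0 ≤ ∑ _i : I, ε / Fintype.card I := by
        refine Finset.sum_le_sum fun i _ => max_le ?_ (by positivity)
        linarith [hyε i]
      rw [Finset.sum_const, Finset.card_univ, nsmul_eq_mul, mul_div_cancel₀ _ hn.ne'] at h2
      linarith
    have h0 : ∀ i, x i ≤ f x i := by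
      intro i
      have h1 := Finset.single_le_sum (f := fun i => max (x i - f x i) 0)
        (fun i _ => le_max_right _ _) (Finset.mem_univ i)
      have h2 := le_max_left (x i - f x i) 0
      linarith
    refine ⟨x, hx, ?_⟩
    have h1 : ∑ i, (f x i - x i) = 0 := by
      rw [Finset.sum_sub_distrib, hx.2, (hmaps hx).2, sub_self]
    have h2 := (Finset.sum_eq_zero_iff_of_nonneg (fun i _ => sub_nonneg.2 (h0 i))).1 h1
    funext i
    linarith [h2 i (Finset.mem_univ i)]

/-- Ky Fan type consequence of Brouwer's theorem. -/
theorem no_open_descent {E : Type*} [NormedAddCommGroup E] [NormedSpace ℝ E] {K : Set E}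
    (hconv : Convex ℝ K) (hcpt : IsCompact K) (hne : K.Nonempty) (g : E → E →ₗ[ℝ] ℝ)
    (h : ∀ x ∈ K, ∃ y ∈ K, ∀ᶠ x' in nhds x, g x' (y - x') < 0) : False := by
  classical
  have h' : ∀ x : E, ∃ y : E, ∃ U : Set E, IsOpen U ∧ (x ∈ K → x ∈ U ∧ y ∈ K ∧
      ∀ x' ∈ U, g x' (y - x') < 0) := by
    intro x
    by_cases hx : x ∈ K
    · obtain ⟨y, hy, hev⟩ := h x hx
      obtain ⟨U, hU, hUo, hxU⟩ := eventually_nhds_iff.1 hev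
      exact ⟨y, U, hUo, fun _ => ⟨hxU, hy, hU⟩⟩
    · exact ⟨0, ∅, isOpen_empty, fun h => absurd h hx⟩
  choose y U hUo hU using h'
  obtain ⟨t, htK, htcov⟩ := hcpt.elim_nhds_subcover U
    (fun x hx => (hUo x).mem_nhds (hU x hx).1)
  obtain ⟨ρ, hρ⟩ := PartitionOfUnity.exists_isSubordinate_of_locallyFinite hcpt.isClosed
    (fun i : t => U i.1) (fun i => hUo i.1) (locallyFinite_of_finite _) (by
      intro x hx
      obtain ⟨i, hi, hxi⟩ := Set.mem_iUnion₂.1 (htcov hx)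
      exact Set.mem_iUnion.2 ⟨⟨i, hi⟩, hxi⟩)
  have hsum : ∀ x ∈ K, ∑ i, ρ i x = 1 := fun x hx => by
    rw [← finsum_eq_sum_of_fintype]
    exact ρ.sum_eq_one hx
  have htne : Nonempty t := by
    obtain ⟨x, hx⟩ := hne
    obtain ⟨i, hi, _⟩ := Set.mem_iUnion₂.1 (htcov hx)
    exact ⟨⟨i, hi⟩⟩
  let P : (t → ℝ) → E := fun w => ∑ i, w i • y i.1
  have hPK : ∀ w ∈ stdSimplex ℝ t, P w ∈ K := fun w hw =>
    hconv.sum_mem (fun i _ => hw.1 i) hw.2 (fun i _ => (hU i.1 (htK i.1 i.2)).2.1)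
  have hPc : Continuous P := by fun_prop
  obtain ⟨w, hw, hfix⟩ := brouwer_simplex (fun w i => ρ i (P w))
    (Continuous.continuousOn (continuous_pi fun i => (ρ i).continuous.comp hPc))
    (fun w hw => ⟨fun i => ρ.nonneg i _, hsum _ (hPK w hw)⟩)
  have hwi : ∀ i, ρ i (P w) = w i := fun i => congrFun hfix i
  have hzero : ∑ i, w i * g (P w) (y i.1 - P w) = 0 := by
    have : ∑ i, w i • (y i.1 - P w) = 0 := by
      simp_rw [smul_sub]
      rw [Finset.sum_sub_distrib, ← Finset.sum_smul, hw.2, one_smul]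
      exact sub_self _
    have h2 := congrArg (g (P w)) this
    rw [map_sum, map_zero] at h2
    simpa only [map_smul, smul_eq_mul] using h2
  have hmem : ∀ i, 0 < w i → g (P w) (y i.1 - P w) < 0 := by
    intro i hi
    refine (hU i.1 (htK i.1 i.2)).2.2 _ (hρ i (subset_tsupport _ ?_))
    rw [Function.mem_support, hwi]
    exact hi.ne'
  obtain ⟨i, hi⟩ : ∃ i, 0 < w i := by
    by_contra hcon
    push Not at hcon
    have := Finset.sum_nonpos (s := Finset.univ) (fun i _ => hcon i)
    rw [hw.2] at this
    linarith
  have : ∑ i, w i * g (P w) (y i.1 - P w) < ∑ _i : t, (0:ℝ) := by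
    apply Finset.sum_lt_sum
    · intro j _
      rcases (hw.1 j).eq_or_lt with h0 | h0
      · rw [← h0, zero_mul]
      · exact (mul_neg_of_pos_of_neg h0 (hmem j h0)).le
    · exact ⟨i, Finset.mem_univ _, mul_neg_of_pos_of_neg hi (hmem i hi)⟩
  rw [hzero] at this
  simp at this

lemma exists_unit_normal {E : Type*} [NormedAddCommGroup E] [NormedSpace ℝ E] {S : Set E}
    (hconv : Convex ℝ S) (hopen : IsOpen S) {u : E} (hu : u ∉ S) :
    ∃ G : E →L[ℝ] ℝ, ‖G‖ ≤ 1 ∧ ∀ z r, 0 < r → Metric.ball z r ⊆ S → G (z - u) ≤ -r := by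
  rcases S.eq_empty_or_nonempty with hS | ⟨s, hs⟩
  · refine ⟨0, by simp, fun z r hr h => ?_⟩
    have := h (Metric.mem_ball_self hr)
    rw [hS] at this
    exact absurd this (Set.notMem_empty _)
  · obtain ⟨f, hf⟩ := geometric_hahn_banach_open_point hconv hopen hu
    have hf0 : f ≠ 0 := by
      rintro rfl
      exact lt_irrefl _ (hf s hs)
    have hn : 0 < ‖f‖ := norm_pos_iff.2 hf0
    refine ⟨‖f‖⁻¹ • f, ?_, fun z r hr hb => ?_⟩
    · rw [norm_smul, norm_inv, norm_norm, inv_mul_cancel₀ hn.ne']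
    · by_contra hcon
      push Not at hcon
      have h1 : f (u - z) < r * ‖f‖ := by
        have h2 : (‖f‖⁻¹ • f) (z - u) = ‖f‖⁻¹ * f (z - u) := rfl
        rw [h2, inv_mul_eq_div, lt_div_iff₀ hn] at hcon
        rw [← neg_sub, map_neg]
        linarith
      have h3 : f (u - z) / r < ‖f‖ := by
        rw [div_lt_iff₀ hr]; linarith
      obtain ⟨x, hx1, hx⟩ := f.exists_lt_apply_of_lt_opNorm h3
      have key : ∀ x : E, ‖x‖ < 1 → r * f x < f (u - z) := by
        intro x hx
        have := hf (z + r • x) (hb (by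
          rw [mem_ball_iff_norm, add_sub_cancel_left, norm_smul, Real.norm_of_nonneg hr.le]
          nlinarith))
        rw [map_add, map_smul, smul_eq_mul] at this
        rw [map_sub]; linarith
      have k1 := key x hx1
      have k2 := key (-x) (by rwa [norm_neg])
      rw [map_neg] at k2
      rw [div_lt_iff₀ hr, Real.norm_eq_abs] at hx
      rcases abs_cases (f x) with ⟨h, _⟩ | ⟨h, _⟩ <;> rw [h] at hx <;> linarith

lemma qc_local {E X : Type*} [NormedAddCommGroup E] [NormedSpace ℝ E] [FiniteDimensional ℝ E]
    [TopologicalSpace X] (h : X → E → ℝ)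
    (hlpc : ∀ x u z, h x z < h x u → ∀ᶠ u' in nhds u, h x z < h x u')
    (hupc : ∀ x u z, h x u < h x z → ∀ᶠ u' in nhds u, h x u' < h x z)
    (hcont : ∀ u, Continuous fun x => h x u)
    (hqc : ∀ x, QuasiconvexOn ℝ Set.univ (h x))
    (x0 : X) (u0 z : E) (hlt : h x0 z < h x0 u0) :
    ∃ r > 0, ∀ᶠ q : X × E in nhds (x0, u0), ∀ w ∈ Metric.ball z r, h q.1 w < h q.1 q.2 := by
  obtain ⟨b, hb1, hb2⟩ := exists_mem_interior_convexHull_affineBasis (hupc x0 z u0 hlt)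
  obtain ⟨r, hr, hball⟩ := Metric.isOpen_iff.1 isOpen_interior z hb1
  have hbv : ∀ i, h x0 (b i) < h x0 u0 := fun i =>
    hb2 (subset_convexHull ℝ _ (Set.mem_range_self i))
  -- a point on the segment
  have hev : ∀ᶠ u in nhds u0, ∀ i, h x0 (b i) < h x0 u :=
    Filter.eventually_all.2 fun i => hlpc x0 u0 (b i) (hbv i)
  have htend : Filter.Tendsto (fun t : ℝ => (1 - t) • u0 + t • z) (nhds 0) (nhds u0) := by
    have : Continuous fun t : ℝ => (1 - t) • u0 + t • z := by fun_prop
    have h1 := this.tendsto 0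
    simpa using h1
  obtain ⟨t, ht, ht0, ht1⟩ : ∃ t : ℝ, (∀ i, h x0 (b i) < h x0 ((1 - t) • u0 + t • z)) ∧
      0 < t ∧ t < 1 := by
    have h1 := (htend.eventually hev).filter_mono (nhdsWithin_le_nhds (s := Set.Ioi (0:ℝ)))
    have h2 : ∀ᶠ t : ℝ in nhdsWithin 0 (Set.Ioi 0), t < 1 :=
      (gt_mem_nhds one_pos).filter_mono nhdsWithin_le_nhds
    have h3 : ∀ᶠ t : ℝ in nhdsWithin 0 (Set.Ioi 0), 0 < t := self_mem_nhdsWithin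
    obtain ⟨t, h1, h2, h3⟩ := (h1.and (h3.and h2)).exists
    exact ⟨t, h1, h2, h3⟩
  set u1 := (1 - t) • u0 + t • z with hu1
  refine ⟨r, hr, ?_⟩
  have hx : ∀ᶠ x in nhds x0, ∀ i, h x (b i) < h x u1 :=
    Filter.eventually_all.2 fun i =>
      ((hcont (b i)).tendsto x0).eventually_lt ((hcont u1).tendsto x0) (ht i)
  have hu : ∀ᶠ u in nhds u0, z + ((1 - t) / t) • (u0 - u) ∈ Metric.ball z r := by
    have : Continuous fun u => z + ((1 - t) / t) • (u0 - u) := by fun_prop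
    have h1 := this.tendsto u0
    apply h1
    simpa using Metric.ball_mem_nhds z hr
  rw [nhds_prod_eq]
  filter_upwards [hx.prod_mk hu] with ⟨x, u⟩ ⟨hx, hu⟩ w hw
  have hlow : ∀ w ∈ Metric.ball z r, h x w < h x u1 := by
    intro w hw
    have hw' : w ∈ convexHull ℝ (Set.range b) := interior_subset (hball hw)
    have hc : Convex ℝ {v | v ∈ Set.univ ∧ h x v < h x u1} := (hqc x).convex_lt _
    have := convexHull_min (s := Set.range b) (by
      rintro _ ⟨i, rfl⟩
      exact ⟨Set.mem_univ _, hx i⟩) hc hw'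
    exact this.2
  have h1 := hlow w hw
  have h2 := hlow _ hu
  by_contra hcon
  push Not at hcon
  have h3 : h x u < h x u1 := lt_of_le_of_lt hcon h1
  have hc : Convex ℝ {v | v ∈ Set.univ ∧ h x v < h x u1} := (hqc x).convex_lt _
  have h4 := hc (x := u) ⟨Set.mem_univ _, h3⟩ (y := z + ((1 - t) / t) • (u0 - u))
    ⟨Set.mem_univ _, h2⟩ (a := 1 - t) (b := t) (by linarith) ht0.le (by ring)
  have h5 : (1 - t) • u + t • (z + ((1 - t) / t) • (u0 - u)) = u1 := by
    rw [smul_add, smul_smul, mul_div_cancel₀ _ ht0.ne', smul_sub, hu1]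
    abel
  rw [h5] at h4
  exact lt_irrefl _ h4.2


/-- Main existence theorem for jointly convex GNEPs: if `𝔛 ⊆ ℝⁿ` is convex, compact and
nonempty, and each loss function `θ_ν` is pseudocontinuous (lower and upper) in its own
player's variable, continuous in the rivals' variables and quasiconvex in its own player's
variable, then a generalized Nash equilibrium exists. -/
theorem jointly_convex_gnep_exists {N : Type*} [Fintype N] [DecidableEq N] (n : N → ℕ)
    (𝔛 : Set ((ν : N) → EuclideanSpace ℝ (Fin (n ν))))
    (h𝔛conv : Convex ℝ 𝔛) (h𝔛cpt : IsCompact 𝔛) (h𝔛ne : 𝔛.Nonempty)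
    (θ : N → ((ν : N) → EuclideanSpace ℝ (Fin (n ν))) → ℝ)
    (hlpc : ∀ (ν : N) (x : (ν : N) → EuclideanSpace ℝ (Fin (n ν)))
      (u z : EuclideanSpace ℝ (Fin (n ν))),
      θ ν (Function.update x ν z) < θ ν (Function.update x ν u) →
      ∃ V ∈ nhds u, ∀ u' ∈ V, θ ν (Function.update x ν z) < θ ν (Function.update x ν u'))
    (hupc : ∀ (ν : N) (x : (ν : N) → EuclideanSpace ℝ (Fin (n ν)))
      (u z : EuclideanSpace ℝ (Fin (n ν))),
      θ ν (Function.update x ν z) > θ ν (Function.update x ν u) →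
      ∃ V ∈ nhds u, ∀ u' ∈ V, θ ν (Function.update x ν z) > θ ν (Function.update x ν u'))
    (hcont : ∀ (ν : N) (u : EuclideanSpace ℝ (Fin (n ν))),
      Continuous fun x : (ν : N) → EuclideanSpace ℝ (Fin (n ν)) => θ ν (Function.update x ν u))
    (hqc : ∀ (ν : N) (x : (ν : N) → EuclideanSpace ℝ (Fin (n ν)))
      (u v : EuclideanSpace ℝ (Fin (n ν))) (t : ℝ), 0 ≤ t → t ≤ 1 →
      θ ν (Function.update x ν (t • u + (1 - t) • v)) ≤
        max (θ ν (Function.update x ν u)) (θ ν (Function.update x ν v))) :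
    ∃ x ∈ 𝔛, ∀ (ν : N) (z : EuclideanSpace ℝ (Fin (n ν))),
      Function.update x ν z ∈ 𝔛 → θ ν x ≤ θ ν (Function.update x ν z) := by
  classical
  by_contra hcon
  push Not at hcon
  have hqc' : ∀ (ν : N) (x : (ν : N) → EuclideanSpace ℝ (Fin (n ν))),
      QuasiconvexOn ℝ Set.univ fun u => θ ν (Function.update x ν u) := by
    intro ν x
    rw [quasiconvexOn_iff_le_max]
    refine ⟨convex_univ, fun u _ v _ a b ha hb hab => ?_⟩
    have hb' : b = 1 - a := by linarith
    subst hb'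
    exact hqc ν x u v a ha (by linarith)
  have hG : ∀ (x : (ν : N) → EuclideanSpace ℝ (Fin (n ν))) (ν : N),
      ∃ G : EuclideanSpace ℝ (Fin (n ν)) →L[ℝ] ℝ, ‖G‖ ≤ 1 ∧ ∀ z r, 0 < r →
        Metric.ball z r ⊆ {w | θ ν (Function.update x ν w) < θ ν x} → G (z - x ν) ≤ -r := by
    intro x ν
    apply exists_unit_normal
    · have := (hqc' ν x).convex_lt (θ ν x)
      simpa using this
    · rw [isOpen_iff_mem_nhds]
      intro w hw
      obtain ⟨V, hV, hVw⟩ := hupc ν x w (x ν) (by rw [Function.update_eq_self]; exact hw)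
      rw [Function.update_eq_self] at hVw
      exact Filter.mem_of_superset hV hVw
    · simp
  choose G hG1 hG2 using hG
  refine no_open_descent h𝔛conv h𝔛cpt h𝔛ne
    (fun x => ∑ ν, (G x ν).toLinearMap ∘ₗ LinearMap.proj ν) ?_
  intro x hx
  obtain ⟨ν, z, hz, hlt⟩ := hcon x hx
  refine ⟨_, hz, ?_⟩
  obtain ⟨r, hr, hev⟩ := qc_local (fun x u => θ ν (Function.update x ν u))
    (fun x u z h => by
      obtain ⟨V, hV, h⟩ := hlpc ν x u z h
      exact Filter.mem_of_superset hV h)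
    (fun x u z h => by
      obtain ⟨V, hV, h⟩ := hupc ν x u z h
      exact Filter.mem_of_superset hV h)
    (hcont ν) (hqc' ν) x (x ν) z (by simpa using hlt)
  have htend : Filter.Tendsto (fun x' : (ν : N) → EuclideanSpace ℝ (Fin (n ν)) => (x', x' ν))
      (nhds x) (nhds (x, x ν)) := by
    have : Continuous fun x' : (ν : N) → EuclideanSpace ℝ (Fin (n ν)) => (x', x' ν) := by fun_prop
    exact this.tendsto x
  have hsm : ∀ᶠ x' in nhds x, ∑ μ, ‖x μ - x' μ‖ < r := by
    have : Continuous fun x' : (ν : N) → EuclideanSpace ℝ (Fin (n ν)) => ∑ μ, ‖x μ - x' μ‖ := by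
      fun_prop
    apply this.continuousAt.eventually_lt continuousAt_const
    simpa using hr
  filter_upwards [htend.eventually hev, hsm] with x' h1 h2
  have h3 : G x' ν (z - x' ν) ≤ -r := by
    apply hG2 x' ν z r hr
    intro w hw
    have := h1 w hw
    simpa using this
  have h4 : (∑ ν, (G x' ν).toLinearMap ∘ₗ LinearMap.proj ν) (Function.update x ν z - x') =
      ∑ μ, G x' μ (Function.update x ν z μ - x' μ) := by
    simp [LinearMap.sum_apply]
  rw [h4, ← Finset.add_sum_erase _ _ (Finset.mem_univ ν), Function.update_self]
  have h5 : ∑ μ ∈ Finset.univ.erase ν, G x' μ (Function.update x ν z μ - x' μ) ≤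
      ∑ μ ∈ Finset.univ.erase ν, ‖x μ - x' μ‖ := by
    refine Finset.sum_le_sum fun μ hμ => ?_
    rw [Function.update_of_ne (Finset.ne_of_mem_erase hμ)]
    refine (le_abs_self _).trans (((G x' μ).le_opNorm _).trans ?_)
    exact mul_le_of_le_one_left (norm_nonneg _) (hG1 x' μ)
  have h6 : ∑ μ ∈ Finset.univ.erase ν, ‖x μ - x' μ‖ ≤ ∑ μ, ‖x μ - x' μ‖ :=
    Finset.sum_le_sum_of_subset_of_nonneg (Finset.erase_subset _ _) fun _ _ _ => norm_nonneg _
  linarith
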